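/- arXiv:1808.09086 — 9 statements merged into one kernel-verified Lean document; each statement's English description precedes it below -/
import Mathlib

section
/- Let (g_n)_{n∈ℤ} be a family of C^∞ functions g_n : ℝ² → ℝ such that for every n ∈ ℤ and all real x_{n+1}, x_n, x_{n−1} one has ∂₂g_n(x_{n+1}, x_n) + ∂₁g_{n−1}(x_n, x_{n−1}) = 0 (where ∂₁, ∂₂ denote the partial derivatives with respect to the first and second arguments). Then (g_n) is a total difference: there exists a family (f_n)_{n∈ℤ} of C^∞ functions f_n : ℝ → ℝ with g_n(x_{n+1}, x_n) = f_{n+1}(x_{n+1}) − f_n(x_n) for all n and all x_{n+1}, x_n. -/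
/-- Every sequence indexed by `ℤ` has an antidifference. -/
theorem exists_int_antidifference {G : Type*} [AddCommGroup G] (h : ℤ → G) :
    ∃ s : ℤ → G, ∀ n, s (n + 1) = s n + h n := by
  refine ⟨fun n => ∑ k ∈ Finset.range n.toNat, h k -
    ∑ k ∈ Finset.range (-n).toNat, h (-(k : ℤ) - 1), fun n => ?_⟩
  dsimp only
  rcases le_or_gt 0 n with hn | hn
  · lift n to ℕ using hn
    rw [show ((n : ℤ) + 1).toNat = n + 1 by lia, show (-((n : ℤ) + 1)).toNat = 0 by lia,
      show (n : ℤ).toNat = n by lia, show (-(n : ℤ)).toNat = 0 by lia, Finset.sum_range_succ]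
    simp
  · obtain ⟨m, rfl⟩ : ∃ m : ℕ, n = -(m : ℤ) - 1 := ⟨(-n - 1).toNat, by lia⟩
    rw [show (-(m : ℤ) - 1 + 1).toNat = 0 by lia, show (-(-(m : ℤ) - 1 + 1)).toNat = m by lia,
      show (-(m : ℤ) - 1).toNat = 0 by lia, show (-(-(m : ℤ) - 1)).toNat = m + 1 by lia,
      Finset.sum_range_succ]
    abel

/-- Base case `k = 1` of the statement that the kernel of the discrete Euler operator
consists of total differences. Here `g n a b` stands for `g_n(x_{n+1}, x_n)` with
`a = x_{n+1}`, `b = x_n`. -/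
theorem kernel_of_euler_operator_is_total_difference_k_eq_one
    (g : ℤ → ℝ → ℝ → ℝ)
    (hg : ∀ n, ContDiff ℝ (⊤ : ℕ∞) (fun p : ℝ × ℝ => g n p.1 p.2))
    (hker : ∀ (n : ℤ) (a b c : ℝ),
      deriv (fun t => g n a t) b + deriv (fun t => g (n - 1) t c) b = 0) :
    ∃ f : ℤ → ℝ → ℝ, (∀ n, ContDiff ℝ (⊤ : ℕ∞) (f n)) ∧
      ∀ (n : ℤ) (a b : ℝ), g n a b = f (n + 1) a - f n b := by
  have contDiff_right (n : ℤ) (a : ℝ) : ContDiff ℝ (⊤ : ℕ∞) (fun t => g n a t) :=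
    (hg n).comp (contDiff_const.prodMk contDiff_id)
  have contDiff_left (n : ℤ) (c : ℝ) : ContDiff ℝ (⊤ : ℕ∞) (fun t => g n t c) :=
    (hg n).comp (contDiff_id.prodMk contDiff_const)
  have sum_const (n : ℤ) (a b c : ℝ) : g n a b + g (n - 1) b c = g n a 0 + g (n - 1) 0 c := by
    have hr := (contDiff_right n a).differentiable (by simp)
    have hl := (contDiff_left (n - 1) c).differentiable (by simp)
    refine is_const_of_deriv_eq_zero (f := fun t => g n a t + g (n - 1) t c)
      (hr.add hl) (fun t => ?_) b 0
    rw [deriv_fun_add (hr t) (hl t)]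
    exact hker n a t c
  obtain ⟨s, hs⟩ := exists_int_antidifference fun n => g (n + 1) 0 0
  refine ⟨fun n b => s n - g n 0 b, fun n => contDiff_const.sub (contDiff_right n 0),
    fun n a b => ?_⟩
  have h₁ := sum_const (n + 1) 0 a 0
  rw [add_sub_cancel_right] at h₁
  have h₂ := sum_const n a b 0
  have h₃ := sum_const n 0 b 0
  linarith [hs n]
end

section
/- Let k ≥ 1 and let (g_n)_{n∈ℤ} be a family of C^∞ functions g_n : ℝ^{k+1} → ℝ lying in the kernel of the discrete Euler operator, i.e. for every n ∈ ℤ and all real numbers x_{n+k}, …, x_{n−k} one has Σ_{l=0}^{k} ∂_{l+1} g_{n−l}(x_{n+k−l}, …, x_{n−l}) = 0, where ∂_{l+1} denotes the partial derivative with respect to the (l+1)-th argument (the slot occupied by x_n). Then (g_n) is a total difference: there exists a family (f_n)_{n∈ℤ} of C^∞ functions f_n : ℝ^k → ℝ with g_n(x_{n+k}, …, x_n) = f_{n+1}(x_{n+k}, …, x_{n+1}) − f_n(x_{n+k−1}, …, x_n) for all n and all arguments. -/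
/-- The discrete Euler--Lagrange expression of a discrete Lagrangian of order `k`:
`E(L)_n(x) = ∑_{l=0}^{k} ∂L_{n-l}/∂x_n (x_{n+k-l},…,x_{n-l})`, where the `2k+1`
variables `(x_{n+k},…,x_{n-k})` are encoded as `x : Fin (2k+1) → ℝ` with index `m`
corresponding to `x_{n+k-m}`, and each `L_n : ℝ^{k+1} → ℝ` is written
`L_n(x_{n+k},…,x_n)` (argument slot `j` corresponding to `x_{n+k-j}`). -/
noncomputable def elSum (k : ℕ) (L : ℤ → (Fin (k + 1) → ℝ) → ℝ) (n : ℤ)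
    (x : Fin (2 * k + 1) → ℝ) : ℝ :=
  ∑ l : Fin (k + 1),
    fderiv ℝ (L (n - l.val))
      (fun j : Fin (k + 1) => x ⟨l.val + j.val, by have := l.isLt; have := j.isLt; omega⟩)
      (Pi.single (⟨k - l.val, by omega⟩ : Fin (k + 1)) 1)

/-- The function `g m` evaluated on the window `(y_{m+k}, …, y_m)` of a bi-infinite sequence `y`. -/
def windowEval (k : ℕ) (g : ℤ → (Fin (k + 1) → ℝ) → ℝ) (m : ℤ) (y : ℤ → ℝ) : ℝ :=
  g m (fun j => y (m + k - j))

/-- The sequence equal to `x` on the window `(n+k-1, …, n)` and zero elsewhere. -/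
def extendByZero (k : ℕ) (n : ℤ) (x : Fin k → ℝ) (q : ℤ) : ℝ :=
  if h : n ≤ q ∧ q < n + k then x ⟨(n + k - 1 - q).toNat, by omega⟩ else 0

theorem windowEval_congr {k : ℕ} (g : ℤ → (Fin (k + 1) → ℝ) → ℝ) {m : ℤ} {y z : ℤ → ℝ}
    (h : ∀ q, m ≤ q → q ≤ m + k → y q = z q) : windowEval k g m y = windowEval k g m z := by
  unfold windowEval
  congr 1
  funext j
  have := j.isLt
  exact h _ (by omega) (by omega)

theorem hasDerivAt_window_update (k l : ℕ) (hl : l ≤ k) (p : ℤ) (y : ℤ → ℝ) (t : ℝ) :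
    HasDerivAt (fun s => fun j : Fin (k + 1) => Function.update y p s (p - l + k - j))
      (Pi.single (⟨k - l, by omega⟩ : Fin (k + 1)) (1 : ℝ)) t := by
  rw [hasDerivAt_pi]
  intro j
  by_cases hj : j = ⟨k - l, by omega⟩
  · subst hj
    have hp : p - l + k - ((k - l : ℕ) : ℤ) = p := by omega
    simpa [hp] using hasDerivAt_id' t
  · have hp : p - l + k - (j : ℤ) ≠ p := by
      intro h
      exact hj (Fin.ext (by simp only; omega))
    simpa [Function.update_of_ne hp, Pi.single_eq_of_ne hj] using
      hasDerivAt_const t (y (p - l + k - j))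

/-- If `g` is in the kernel of the Euler operator, the sum of all `g m` whose window contains `p`
does not depend on the value at `p`. -/
theorem sum_windowEval_update {k : ℕ} {g : ℤ → (Fin (k + 1) → ℝ) → ℝ}
    (hg : ∀ n, Differentiable ℝ (g n))
    (hker : ∀ (n : ℤ) (x : Fin (2 * k + 1) → ℝ), elSum k g n x = 0)
    (p : ℤ) (y : ℤ → ℝ) (s t : ℝ) :
    ∑ l ∈ Finset.range (k + 1), windowEval k g (p - l) (Function.update y p s) =
      ∑ l ∈ Finset.range (k + 1), windowEval k g (p - l) (Function.update y p t) := by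
  have hderiv (t : ℝ) : HasDerivAt
      (fun s => ∑ l : Fin (k + 1), windowEval k g (p - l.val) (Function.update y p s)) 0 t := by
    rw [← hker p (fun m => Function.update y p t (p + k - m.val))]
    refine HasDerivAt.fun_sum fun l _ => ?_
    have hwin : (fun j : Fin (k + 1) => Function.update y p t (p + k - ((l.val + j.val : ℕ) : ℤ))) =
        fun j : Fin (k + 1) => Function.update y p t (p - l.val + k - j) := by
      funext j
      congr 1
      push_cast
      ring
    rw [hwin]
    exact (hg _ _).hasFDerivAt.comp_hasDerivAt t
      (hasDerivAt_window_update k l (by have := l.isLt; omega) p y t)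
  have hconst := is_const_of_deriv_eq_zero (fun t => (hderiv t).differentiableAt)
    (fun t => (hderiv t).deriv) s t
  simpa only [Finset.sum_range] using hconst

theorem exists_int_antidifference_s2 (a : ℤ → ℝ) : ∃ c : ℤ → ℝ, ∀ n, c (n + 1) - c n = a n := by
  refine ⟨fun n => ∑ i ∈ Finset.range n.toNat, a i - ∑ i ∈ Finset.range (-n).toNat, a (-i - 1),
    fun n => ?_⟩
  rcases n with n | n
  · have h1 : (Int.ofNat n + 1).toNat = n + 1 := by simp
    have h2 : (-(Int.ofNat n + 1)).toNat = 0 := by simp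
    have h3 : (-Int.ofNat n).toNat = 0 := by simp
    have h4 : (Int.ofNat n).toNat = n := rfl
    simp only [h1, h2, h3, h4, Finset.sum_range_succ, Finset.range_zero, Finset.sum_empty]
    simp
  · have h1 : (Int.negSucc n + 1).toNat = 0 := by omega
    have h2 : (-(Int.negSucc n + 1)).toNat = n := by omega
    have h3 : (-Int.negSucc n).toNat = n + 1 := by omega
    have h4 : (Int.negSucc n).toNat = 0 := rfl
    have h5 : -(n : ℤ) - 1 = Int.negSucc n := by omega
    simp only [h1, h2, h3, h4, Finset.sum_range_succ, Finset.range_zero, Finset.sum_empty, h5]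
    ring

theorem contDiff_windowEval_extendByZero {k : ℕ} {g : ℤ → (Fin (k + 1) → ℝ) → ℝ} {r : WithTop ℕ∞}
    (hg : ∀ n, ContDiff ℝ r (g n)) (m n : ℤ) :
    ContDiff ℝ r (fun x => windowEval k g m (extendByZero k n x)) := by
  refine (hg m).comp (contDiff_pi.2 fun j => ?_)
  unfold extendByZero
  split_ifs
  · exact contDiff_apply ℝ ℝ _
  · exact contDiff_const

/-- The kernel of the discrete Euler operator consists of total differences. -/
theorem kernel_of_euler_operator_is_total_difference (k : ℕ) (hk : 1 ≤ k)
    (g : ℤ → (Fin (k + 1) → ℝ) → ℝ)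
    (hg : ∀ n, ContDiff ℝ (⊤ : ℕ∞) (g n))
    (hker : ∀ (n : ℤ) (x : Fin (2 * k + 1) → ℝ), elSum k g n x = 0) :
    ∃ f : ℤ → (Fin k → ℝ) → ℝ, (∀ n, ContDiff ℝ (⊤ : ℕ∞) (f n)) ∧
      ∀ (n : ℤ) (x : Fin (k + 1) → ℝ),
        g n x = f (n + 1) (fun j => x j.castSucc) - f n (fun j => x j.succ) := by
  obtain ⟨c, hc⟩ := exists_int_antidifference_s2 fun n => windowEval k g (n - k) 0
  refine ⟨fun n x => c n + ∑ l ∈ Finset.range k, windowEval k g (n - 1 - l) (extendByZero k n x),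
    fun n => contDiff_const.add
      (ContDiff.sum fun l _ => contDiff_windowEval_extendByZero hg _ _), fun n x => ?_⟩
  set u := extendByZero k (n + 1) fun j => x j.castSucc with hu
  set v := extendByZero k n fun j => x j.succ with hv
  set y := Function.update u n (x (Fin.last k)) with hy
  have hsum := sum_windowEval_update (fun n => (hg n).differentiable (by simp)) hker n u
    (x (Fin.last k)) (u n)
  rw [Function.update_eq_self, ← hy, Finset.sum_range_succ', Finset.sum_range_succ] at hsum
  have hlast : windowEval k g (n - k) u = windowEval k g (n - k) 0 :=
    windowEval_congr g fun q _ hq => by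
      rw [hu, extendByZero, dif_neg (by omega)]
      rfl
  have hfirst : windowEval k g (n - (0 : ℕ)) y = g n x := by
    unfold windowEval
    simp only [Nat.cast_zero, sub_zero]
    congr 1
    funext j
    rcases Fin.eq_castSucc_or_eq_last j with ⟨i, rfl⟩ | rfl
    · have := i.isLt
      rw [hy, Function.update_of_ne (by simp only [Fin.val_castSucc]; omega), hu, extendByZero,
        dif_pos (by simp only [Fin.val_castSucc]; omega)]
      congr 1
      ext
      simp only [Fin.val_castSucc]
      omega
    · simp [hy]
  have hprev : ∀ l ∈ Finset.range k,
      windowEval k g (n - 1 - l) v = windowEval k g (n - (l + 1 : ℕ)) y := fun l _ => by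
    have hm : n - 1 - (l : ℤ) = n - (l + 1 : ℕ) := by push_cast; ring
    rw [hm]
    refine windowEval_congr g fun q _ hq => ?_
    rcases lt_trichotomy q n with h | rfl | h
    · rw [hy, Function.update_of_ne h.ne, hu, hv, extendByZero, extendByZero,
        dif_neg (by omega), dif_neg (by omega)]
    · rw [hy, Function.update_self, hv, extendByZero, dif_pos (by omega)]
      congr 1
      ext
      simp only [Fin.val_succ, Fin.val_last]
      omega
    · rw [hy, Function.update_of_ne h.ne', hu, hv, extendByZero, extendByZero,
        dif_pos (by omega), dif_pos (by omega)]
      congr 1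
      ext
      simp only [Fin.val_succ, Fin.val_castSucc]
      omega
  simp only [add_sub_cancel_right]
  rw [← hu, ← hv, Finset.sum_congr rfl hprev]
  have := hc n
  linarith
end

section
/- Let k ≥ 1 and let (L_n)_{n∈ℤ} be a discrete Lagrangian of order k such that the mixed partial derivative of each L_n with respect to its first argument (the slot of x_{n+k}) and its last argument (the slot of x_n) vanishes identically on ℝ^{k+1}. Then (L_n) is equivalent to a discrete Lagrangian depending on one fewer point: there exist a family (M_n)_{n∈ℤ} of C^∞ functions M_n : ℝ^k → ℝ and a family (f_n)_{n∈ℤ} of C^∞ functions f_n : ℝ^k → ℝ with L_n(x_{n+k}, …, x_n) = M_n(x_{n+k−1}, …, x_n) + f_{n+1}(x_{n+k}, …, x_{n+1}) − f_n(x_{n+k−1}, …, x_n) for all n and all arguments. -/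
section DirectionalDerivative

variable {E : Type*} [NormedAddCommGroup E] [NormedSpace ℝ E]

/-- A differentiable function whose derivative in direction `v` vanishes is invariant under
translation along `v`. -/
theorem Differentiable.apply_add_smul_eq_of_fderiv_eq_zero {h : E → ℝ} (hh : Differentiable ℝ h)
    {v : E} (hv : ∀ x, fderiv ℝ h x v = 0) (x : E) (t : ℝ) : h (x + t • v) = h x := by
  have hd : ∀ s : ℝ, HasDerivAt (fun s : ℝ => h (x + s • v)) 0 s := fun s => by
    have hline : HasDerivAt (fun s : ℝ => x + s • v) v s := by
      simpa using ((hasDerivAt_id s).smul_const v).const_add x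
    exact hv (x + s • v) ▸ (hh (x + s • v)).hasFDerivAt.comp_hasDerivAt s hline
  simpa using is_const_of_deriv_eq_zero (fun s => (hd s).differentiableAt)
    (fun s => (hd s).deriv) t 0

/-- If the mixed second derivative of `g` in directions `u` and `v` vanishes, then so do the mixed
second differences of `g` along `u` and `v`. -/
theorem ContDiff.sub_eq_sub_of_fderiv_fderiv_eq_zero {g : E → ℝ} (hg : ContDiff ℝ 2 g) {u v : E}
    (huv : ∀ x, fderiv ℝ (fun y => fderiv ℝ g y u) x v = 0) (x : E) (s t : ℝ) :
    g (x + s • u + t • v) - g (x + s • u) = g (x + t • v) - g x := by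
  have hgd : Differentiable ℝ g := hg.differentiable (by norm_num)
  have hDd : Differentiable ℝ fun y => fderiv ℝ g y u :=
    ((hg.fderiv_right (m := 1) (by norm_num)).clm_apply contDiff_const).differentiable
      (by norm_num)
  have hshift : Differentiable ℝ fun y => g (y + t • v) := by fun_prop
  refine Differentiable.apply_add_smul_eq_of_fderiv_eq_zero (h := fun y => g (y + t • v) - g y)
    (hshift.sub hgd) (fun y => ?_) x s
  rw [fderiv_fun_sub (hshift y) (hgd y), fderiv_comp_add_right, sub_apply,
    hDd.apply_add_smul_eq_of_fderiv_eq_zero huv y t, sub_self]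

end DirectionalDerivative

theorem Function.update_eq_add_smul_single {ι : Type*} [DecidableEq ι] (x : ι → ℝ) (i : ι)
    (a : ℝ) : Function.update x i a = x + (a - x i) • Pi.single i (1 : ℝ) := by
  ext j
  rcases eq_or_ne j i with rfl | hj
  · simp
  · simp [hj]

theorem ContDiff.fin_cons_zero {k : ℕ} {n : WithTop ℕ∞} :
    ContDiff ℝ n fun z : Fin k → ℝ => (Fin.cons 0 z : Fin (k + 1) → ℝ) := by
  refine contDiff_pi.2 fun i => ?_
  cases i using Fin.cases with
  | zero => simpa using contDiff_const
  | succ j => simpa using contDiff_apply ℝ ℝ j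

theorem ContDiff.fin_snoc_zero {k : ℕ} {n : WithTop ℕ∞} :
    ContDiff ℝ n fun z : Fin k → ℝ => (Fin.snoc z 0 : Fin (k + 1) → ℝ) := by
  refine contDiff_pi.2 fun i => ?_
  cases i using Fin.lastCases with
  | last => simpa using contDiff_const
  | cast j => simpa using contDiff_apply ℝ ℝ j


/-- A discrete Lagrangian whose mixed partial derivative with respect to the slots of
`x_{n+k}` (first argument) and `x_n` (last argument) vanishes identically is
equivalent, up to a total difference, to a Lagrangian on one fewer point. -/
theorem non_normal_lagrangian_reduces (k : ℕ) (hk : 1 ≤ k)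
    (L : ℤ → (Fin (k + 1) → ℝ) → ℝ) (hL : ∀ n, ContDiff ℝ (⊤ : ℕ∞) (L n))
    (hmix : ∀ (n : ℤ) (x : Fin (k + 1) → ℝ),
      fderiv ℝ (fun y => fderiv ℝ (L n) y (Pi.single (0 : Fin (k + 1)) 1)) x
        (Pi.single (Fin.last k) 1) = 0) :
    ∃ (M : ℤ → (Fin k → ℝ) → ℝ) (f : ℤ → (Fin k → ℝ) → ℝ),
      (∀ n, ContDiff ℝ (⊤ : ℕ∞) (M n)) ∧ (∀ n, ContDiff ℝ (⊤ : ℕ∞) (f n)) ∧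
      ∀ (n : ℤ) (x : Fin (k + 1) → ℝ),
        L n x = M n (fun j => x j.succ)
          + f (n + 1) (fun j => x j.castSucc) - f n (fun j => x j.succ) := by
  let c : (Fin k → ℝ) → Fin (k + 1) → ℝ := fun z => Fin.cons 0 z
  let d : (Fin k → ℝ) → Fin (k + 1) → ℝ := fun z => Fin.snoc z 0
  let p : (Fin (k + 1) → ℝ) → Fin k → ℝ := fun x j => x j.castSucc
  have hc : ContDiff ℝ (⊤ : ℕ∞) c := ContDiff.fin_cons_zero
  have hd : ContDiff ℝ (⊤ : ℕ∞) d := ContDiff.fin_snoc_zero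
  have hp : ContDiff ℝ (⊤ : ℕ∞) p := contDiff_pi.2 fun j => contDiff_apply ℝ ℝ j.castSucc
  let f : ℤ → (Fin k → ℝ) → ℝ := fun n z => L (n - 1) (d z)
  have hf : ∀ n, ContDiff ℝ (⊤ : ℕ∞) (f n) := fun n => (hL (n - 1)).comp hd
  refine ⟨fun n z => L n (c z) - L n (d (p (c z))) + f n z, f,
    fun n => (((hL n).comp hc).sub ((hL n).comp (hd.comp (hp.comp hc)))).add (hf n), hf,
    fun n x => ?_⟩
  have h0 : Fin.last k ≠ 0 := Fin.ne_of_gt (Fin.lt_def.2 hk)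
  have hdp : ∀ y, d (p y) = Function.update y (Fin.last k) 0 := fun y => by
    ext i
    cases i using Fin.lastCases <;> simp [d, p, Fin.castSucc_ne_last]
  have hcx : c (fun j => x j.succ) = Function.update x 0 0 := by
    ext i
    cases i using Fin.cases <;> simp [c]
  have key := (contDiff_infty.1 (hL n) 2).sub_eq_sub_of_fderiv_fderiv_eq_zero
    (hmix n) x (0 - x 0) (0 - x (Fin.last k))
  have hlast : Function.update x 0 0 (Fin.last k) = x (Fin.last k) :=
    Function.update_of_ne h0 _ _
  rw [← Function.update_eq_add_smul_single x 0, ← hlast,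
    ← Function.update_eq_add_smul_single (Function.update x 0 0), hlast,
    ← Function.update_eq_add_smul_single x] at key
  have hfx : f (n + 1) (fun j => x j.castSucc) = L n (Function.update x (Fin.last k) 0) := by
    rw [← hdp x]
    simp [f, p]
  simp only [hcx, hdp, hfx]
  linarith
end

section
/- Let k ≥ 2 and let F : ℝ^{2k} → ℝ be a C^∞ function of the variables (x_{n+k−1}, …, x_{n−k}) whose partial derivative with respect to x_{n−k} is nowhere zero. Let A_i : ℝ^{2k} → ℝ, for i = −k, …, k−1, be C^∞ functions such that for every C^∞ function G : ℝ^{k+1} → ℝ the expression Σ_{i=−k}^{k−1} A_i(x) · ∂/∂x_{n+i}[ G(F(x_{n+k−1}, …, x_{n−k}), x_{n+k−1}, …, x_n) ] vanishes identically on ℝ^{2k}. Then A_i ≡ 0 for all i = 0, 1, …, k−1, and there exist C^∞ functions c_1, …, c_{k−1} : ℝ^{2k} → ℝ such that for each m = 1, …, k−1 one has A_{−m} = −c_m · ∂F/∂x_{n−k} and A_{−k} = Σ_{m=1}^{k−1} c_m · ∂F/∂x_{n−m}; equivalently, the operator Σ_i A_i ∂/∂x_{n+i} is a pointwise linear combination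 of the forward annihilation operators A_m^+ = (∂F/∂x_{n−m}) ∂/∂x_{n−k} − (∂F/∂x_{n−k}) ∂/∂x_{n−m}, m = 1, …, k−1. -/
/-- A sum over `Fin (2 * k)` whose first `k` terms vanish, with the last term split off. -/
theorem sum_fin_two_mul_of_eq_zero {k : ℕ} (hk : 0 < k) (f : Fin (2 * k) → ℝ)
    (hf : ∀ i : Fin (2 * k), i.val < k → f i = 0) :
    ∑ i, f i = ∑ m : Fin (k - 1), f ⟨k + m.val, by have := m.isLt; omega⟩
      + f ⟨2 * k - 1, by omega⟩ := by
  have h : k + ((k - 1) + 1) = 2 * k := by omega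
  rw [← (finCongr h).sum_comp, Fin.sum_univ_add, Fin.sum_univ_castSucc,
    Finset.sum_eq_zero fun i _ => hf _ i.isLt, zero_add]
  congr 2
  ext
  simp only [finCongr_apply, Fin.val_cast, Fin.val_natAdd, Fin.val_last]
  omega


/-- Characterisation of the operators annihilating all functions evaluated on the
solutions of the recurrence `x_{n+k} = F(x_{n+k-1},…,x_{n-k})`, `k ≥ 2`.
The `2k` variables `(x_{n+k-1},…,x_{n-k})` are encoded as `Fin (2k) → ℝ` with index
`i` corresponding to `x_{n+k-1-i}`; thus the coefficient `A_i` of `∂/∂x_{n+i}` of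
the paper corresponds to `A ⟨k-1-i⟩` here, `x_{n-k}` is index `2k-1` and `x_{n-m}`
is index `k-1+m`. Every annihilating operator is a pointwise linear combination of
the forward annihilation operators
`A_m^+ = (∂F/∂x_{n-m}) ∂/∂x_{n-k} - (∂F/∂x_{n-k}) ∂/∂x_{n-m}`, `m = 1,…,k-1`. -/
theorem forward_annihilation_operators (k : ℕ) (hk : 2 ≤ k)
    (F : (Fin (2 * k) → ℝ) → ℝ) (hF : ContDiff ℝ (⊤ : ℕ∞) F)
    (hFnd : ∀ x : Fin (2 * k) → ℝ,
      fderiv ℝ F x (Pi.single (⟨2 * k - 1, by omega⟩ : Fin (2 * k)) 1) ≠ 0)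
    (A : Fin (2 * k) → (Fin (2 * k) → ℝ) → ℝ) (hA : ∀ i, ContDiff ℝ (⊤ : ℕ∞) (A i))
    (hann : ∀ G : (Fin (k + 1) → ℝ) → ℝ, ContDiff ℝ (⊤ : ℕ∞) G →
      ∀ x : Fin (2 * k) → ℝ,
        ∑ i : Fin (2 * k), A i x *
          fderiv ℝ (fun z : Fin (2 * k) → ℝ =>
              G (Fin.cons (F z) (fun j : Fin k => z ⟨j.val, by have := j.isLt; omega⟩)))
            x (Pi.single i 1) = 0) :
    (∀ i : Fin (2 * k), i.val < k → ∀ x, A i x = 0) ∧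
    ∃ c : Fin (k - 1) → (Fin (2 * k) → ℝ) → ℝ, (∀ m, ContDiff ℝ (⊤ : ℕ∞) (c m)) ∧
      (∀ (m : Fin (k - 1)) (x : Fin (2 * k) → ℝ),
        A ⟨k + m.val, by have := m.isLt; omega⟩ x
          = -(c m x) * fderiv ℝ F x (Pi.single (⟨2 * k - 1, by omega⟩ : Fin (2 * k)) 1)) ∧
      (∀ x : Fin (2 * k) → ℝ,
        A ⟨2 * k - 1, by omega⟩ x
          = ∑ m : Fin (k - 1), c m x *
              fderiv ℝ F x
                (Pi.single (⟨k + m.val, by have := m.isLt; omega⟩ : Fin (2 * k)) 1)) := by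
  have hproj (j : Fin (k + 1)) := hann (fun y => y j) (contDiff_apply ℝ ℝ j)
  have hzero : ∀ i : Fin (2 * k), i.val < k → ∀ x, A i x = 0 := by
    intro i hi x
    have h := hproj (Fin.succ ⟨i.val, hi⟩) x
    simp only [Fin.cons_succ, Fin.eta] at h
    rw [(hasFDerivAt_apply i x).fderiv] at h
    simpa [Pi.single_apply] using h
  refine ⟨hzero, fun m x => -(A ⟨k + m.val, by have := m.isLt; omega⟩ x /
    fderiv ℝ F x (Pi.single (⟨2 * k - 1, by omega⟩ : Fin (2 * k)) 1)), fun m => ?_,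
    fun m x => ?_, fun x => ?_⟩
  · exact ((hA _).div ((hF.fderiv_right (by simp)).clm_apply contDiff_const) hFnd).neg
  · field_simp [hFnd x]
  · have h := hproj 0 x
    simp only [Fin.cons_zero] at h
    rw [sum_fin_two_mul_of_eq_zero (by omega) _ fun i hi => by rw [hzero i hi x, zero_mul]] at h
    rw [← mul_left_inj' (hFnd x), Finset.sum_mul, eq_neg_of_add_eq_zero_right h,
      ← Finset.sum_neg_distrib]
    refine Finset.sum_congr rfl fun m _ => ?_
    field_simp [hFnd x]
end

section
/- Let k ≥ 2 and let F̃ : ℝ^{2k} → ℝ be a C^∞ function of the variables (x_{n+k}, …, x_{n−k+1}) whose partial derivative with respect to x_{n+k} is nowhere zero. Let Ã_i : ℝ^{2k} → ℝ, for i = −k+1, …, k, be C^∞ functions such that for every C^∞ function G̃ : ℝ^{k+1} → ℝ the expression Σ_{i=−k+1}^{k} Ã_i(x) · ∂/∂x_{n+i}[ G̃(x_n, x_{n−1}, …, x_{n−k+1}, F̃(x_{n+k}, …, x_{n−k+1})) ] vanishes identically on ℝ^{2k}. Then Ã_i ≡ 0 for all i = −k+1, …, 0, and there exist C^∞ functions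 c_1, …, c_{k−1} : ℝ^{2k} → ℝ such that for each m = 1, …, k−1 one has Ã_m = −c_m · ∂F̃/∂x_{n+k} and Ã_k = Σ_{m=1}^{k−1} c_m · ∂F̃/∂x_{n+m}; equivalently, the operator Σ_i Ã_i ∂/∂x_{n+i} is a pointwise linear combination of the backward annihilation operators A_m^− = (∂F̃/∂x_{n+m}) ∂/∂x_{n+k} − (∂F̃/∂x_{n+k}) ∂/∂x_{n+m}, m = 1, …, k−1. -/
/-- A sum over `Fin N` whose terms of index at least `k` vanish equals its term of index `0` plus
the terms of indices `k - 1, …, 1`, listed in decreasing order. -/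
theorem Fin.sum_eq_zero_add_sum_sub_of_eq_zero {M : Type*} [AddCommMonoid M] {N k : ℕ} (hk : 0 < k)
    (hkN : k ≤ N) (f : Fin N → M) (hf : ∀ i : Fin N, k ≤ i.val → f i = 0) :
    ∑ i, f i = f ⟨0, by omega⟩ + ∑ m : Fin (k - 1), f ⟨k - (m.val + 1), by omega⟩ := by
  let g : ℕ → M := fun n => if h : n < N then f ⟨n, h⟩ else 0
  have hg (n : ℕ) (h : n < N) : f ⟨n, h⟩ = g n := by simp [g, h]
  have hzero (n : ℕ) (h : k ≤ n) : g n = 0 := by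
    by_cases hn : n < N
    · rw [← hg n hn, hf _ h]
    · simp [g, hn]
  have htrunc : ∑ n ∈ Finset.range N, g n = ∑ n ∈ Finset.range (k - 1 + 1), g n := by
    symm
    apply Finset.sum_subset
    · intro n hn
      simp only [Finset.mem_range] at hn ⊢
      omega
    · intro n _ hn
      simp only [Finset.mem_range] at hn
      exact hzero n (by omega)
  calc ∑ i, f i = ∑ i : Fin N, g i := Finset.sum_congr rfl fun i _ => hg i i.isLt
    _ = ∑ n ∈ Finset.range (k - 1 + 1), g n := by rw [Fin.sum_univ_eq_sum_range g, htrunc]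
    _ = g 0 + ∑ n ∈ Finset.range (k - 1), g (n + 1) := by
      rw [Finset.sum_range_succ', add_comm]
    _ = g 0 + ∑ m : Fin (k - 1), g (k - (m.val + 1)) := by
      rw [← Finset.sum_range_reflect, ← Fin.sum_univ_eq_sum_range]
      congr 1
      refine Finset.sum_congr rfl fun m _ => ?_
      congr 1
      omega
    _ = _ := by simp only [hg]


/-- Characterisation of the operators annihilating all functions evaluated on the
solutions of the backward recurrence `x_{n-k} = F̃(x_{n+k},…,x_{n-k+1})`, `k ≥ 2`.
The `2k` variables `(x_{n+k},…,x_{n-k+1})` are encoded as `Fin (2k) → ℝ` with index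
`i` corresponding to `x_{n+k-i}`; thus the coefficient `Ã_i` of `∂/∂x_{n+i}` of the
paper corresponds to `A ⟨k-i⟩` here, `x_{n+k}` is index `0` and `x_{n+m}` is index
`k-m`. Every annihilating operator is a pointwise linear combination of the
backward annihilation operators
`A_m^- = (∂F̃/∂x_{n+m}) ∂/∂x_{n+k} - (∂F̃/∂x_{n+k}) ∂/∂x_{n+m}`, `m = 1,…,k-1`. -/
theorem backward_annihilation_operators (k : ℕ) (hk : 2 ≤ k)
    (Ft : (Fin (2 * k) → ℝ) → ℝ) (hFt : ContDiff ℝ (⊤ : ℕ∞) Ft)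
    (hFtnd : ∀ x : Fin (2 * k) → ℝ,
      fderiv ℝ Ft x (Pi.single (⟨0, by omega⟩ : Fin (2 * k)) 1) ≠ 0)
    (A : Fin (2 * k) → (Fin (2 * k) → ℝ) → ℝ) (hA : ∀ i, ContDiff ℝ (⊤ : ℕ∞) (A i))
    (hann : ∀ G : (Fin (k + 1) → ℝ) → ℝ, ContDiff ℝ (⊤ : ℕ∞) G →
      ∀ x : Fin (2 * k) → ℝ,
        ∑ i : Fin (2 * k), A i x *
          fderiv ℝ (fun z : Fin (2 * k) → ℝ =>
              G (Fin.snoc (fun s : Fin k => z ⟨k + s.val, by have := s.isLt; omega⟩) (Ft z)))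
            x (Pi.single i 1) = 0) :
    (∀ i : Fin (2 * k), k ≤ i.val → ∀ x, A i x = 0) ∧
    ∃ c : Fin (k - 1) → (Fin (2 * k) → ℝ) → ℝ, (∀ m, ContDiff ℝ (⊤ : ℕ∞) (c m)) ∧
      (∀ (m : Fin (k - 1)) (x : Fin (2 * k) → ℝ),
        A ⟨k - (m.val + 1), by omega⟩ x
          = -(c m x) * fderiv ℝ Ft x (Pi.single (⟨0, by omega⟩ : Fin (2 * k)) 1)) ∧
      (∀ x : Fin (2 * k) → ℝ,
        A ⟨0, by omega⟩ x
          = ∑ m : Fin (k - 1), c m x *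
              fderiv ℝ Ft x
                (Pi.single (⟨k - (m.val + 1), by omega⟩ : Fin (2 * k)) 1)) := by
  have hhigh : ∀ i : Fin (2 * k), k ≤ i.val → ∀ x, A i x = 0 := by
    intro i hi x
    have h := hann (fun y => y (Fin.castSucc ⟨i.val - k, by omega⟩)) (contDiff_apply _ _ _) x
    have hi' : (⟨k + (i.val - k), by omega⟩ : Fin (2 * k)) = i := Fin.ext (by simp; omega)
    have hproj : fderiv ℝ (fun z : Fin (2 * k) → ℝ => z i) x =
        ContinuousLinearMap.proj (R := ℝ) (φ := fun _ : Fin (2 * k) => ℝ) i :=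
      (hasFDerivAt_apply i x).fderiv
    simp only [Fin.snoc_castSucc, hi', hproj] at h
    simpa [Pi.single_apply] using h
  have hlast (x : Fin (2 * k) → ℝ) :
      ∑ i, A i x * fderiv ℝ Ft x (Pi.single i 1) = 0 := by
    have h := hann (fun y => y (Fin.last k)) (contDiff_apply _ _ _) x
    simpa only [Fin.snoc_last] using h
  refine ⟨hhigh, fun m x => -(A ⟨k - (m.val + 1), by omega⟩ x) /
    fderiv ℝ Ft x (Pi.single (⟨0, by omega⟩ : Fin (2 * k)) 1), fun m => ?_, fun m x => ?_,
    fun x => ?_⟩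
  · exact (hA _).neg.div ((hFt.fderiv_right (by simp)).clm_apply contDiff_const) hFtnd
  · have := hFtnd x
    field_simp
  · have hsum := hlast x
    rw [Fin.sum_eq_zero_add_sum_sub_of_eq_zero (by omega : 0 < k) (by omega) _
      (fun i hi => by rw [hhigh i hi x, zero_mul])] at hsum
    simp only [div_mul_eq_mul_div, neg_mul, neg_div, Finset.sum_neg_distrib]
    rw [← Finset.sum_div, ← neg_div, eq_div_iff (hFtnd x)]
    exact eq_neg_of_add_eq_zero_left hsum
end

section
/- Let A, B, C ∈ ℝ and define L : ℝ³ → ℝ by L(z, y, x) = (y² − 1)·x·z + (1/2)·x·y·(x·y + 2C) + (1/2)[(A + B)·log(y − 1) + (A − B)·log(y + 1)] (real logarithm). Then for all real numbers x_{n+2}, x_{n+1}, x_n, x_{n−1}, x_{n−2} with x_n ≠ 1 and x_n ≠ −1, the discrete Euler–Lagrange expression of L satisfies ∂₃L(x_{n+2}, x_{n+1}, x_n) + ∂₂L(x_{n+1}, x_n, x_{n−1}) + ∂₁L(x_n, x_{n−1}, x_{n−2}) = (x_{n+1}² − 1)·x_{n+2} + (x_{n−1}² − 1)·x_{n−2}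 + (x_{n+1} + x_{n−1})·[x_n·(x_{n+1} + x_{n−1}) + C] + (A·x_n + B)/(x_n² − 1). Consequently the Euler–Lagrange equation of L is the autonomous dP_II^(2) equation x_{n+2}(1 − x_{n+1}²) + x_{n−2}(1 − x_{n−1}²) = (x_{n+1} + x_{n−1})[x_n(x_{n+1} + x_{n−1}) + C] − (A·x_n + B)/(1 − x_n²). -/
/-- The Lagrangian `L(z,y,x) = (y²-1)xz + ½xy(xy+2C) + ½[(A+B)log(y-1)+(A-B)log(y+1)]`
has as discrete Euler--Lagrange equation the autonomous dP_II^(2) equation.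
Here `∂ᵢ` is realised as `deriv` of the corresponding one-variable section, and all
three partial derivatives are evaluated with `x_n` in the differentiated slot. -/
theorem el_equation_of_autonomous_dPII2_lagrangian (A B C : ℝ) (L : ℝ → ℝ → ℝ → ℝ)
    (hL : ∀ z y x : ℝ, L z y x
      = (y ^ 2 - 1) * x * z + (1 / 2) * x * y * (x * y + 2 * C)
        + (1 / 2) * ((A + B) * Real.log (y - 1) + (A - B) * Real.log (y + 1))) :
    ∀ x2 x1 x0 xm1 xm2 : ℝ, x0 ≠ 1 → x0 ≠ -1 →
      (deriv (fun t => L x2 x1 t) x0 + deriv (fun t => L x1 t xm1) x0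
          + deriv (fun t => L t xm1 xm2) x0
        = (x1 ^ 2 - 1) * x2 + (xm1 ^ 2 - 1) * xm2
          + (x1 + xm1) * (x0 * (x1 + xm1) + C) + (A * x0 + B) / (x0 ^ 2 - 1)) ∧
      ((deriv (fun t => L x2 x1 t) x0 + deriv (fun t => L x1 t xm1) x0
          + deriv (fun t => L t xm1 xm2) x0 = 0) ↔
        x2 * (1 - x1 ^ 2) + xm2 * (1 - xm1 ^ 2)
          = (x1 + xm1) * (x0 * (x1 + xm1) + C) - (A * x0 + B) / (1 - x0 ^ 2)) := by
  intro x2 x1 x0 xm1 xm2 h1 h2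
  have hm : x0 - 1 ≠ 0 := sub_ne_zero.mpr h1
  have hp : x0 + 1 ≠ 0 := fun h => h2 (eq_neg_of_add_eq_zero_left h)
  have hsq : x0 ^ 2 - 1 ≠ 0 := by
    rw [show x0 ^ 2 - 1 = (x0 - 1) * (x0 + 1) by ring]
    exact mul_ne_zero hm hp
  have hid : HasDerivAt (fun t : ℝ => t) 1 x0 := hasDerivAt_id x0
  have h3 : HasDerivAt (fun t => L x2 x1 t) ((x1 ^ 2 - 1) * x2 + x1 * (x0 * x1 + C)) x0 := by
    simp only [hL]
    refine ((((hid.const_mul (x1 ^ 2 - 1)).mul_const x2).add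
      (((hid.const_mul (1 / 2)).mul_const x1).mul
        ((hid.mul_const x1).add_const (2 * C)))).add_const _).congr_deriv ?_
    ring
  have hmid : HasDerivAt (fun t => L x1 t xm1)
      (2 * x0 * xm1 * x1 + xm1 * (xm1 * x0 + C) + (A * x0 + B) / (x0 ^ 2 - 1)) x0 := by
    simp only [hL]
    refine ((((((hid.pow 2).sub_const 1).mul_const xm1).mul_const x1).add
      ((hid.const_mul (1 / 2 * xm1)).mul
        ((hid.const_mul xm1).add_const (2 * C)))).add
      (((((hid.sub_const 1).log hm).const_mul (A + B)).add
        (((hid.add_const 1).log hp).const_mul (A - B))).const_mul (1 / 2))).congr_deriv ?_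
    have hlog : 1 / 2 * ((A + B) * (1 / (x0 - 1)) + (A - B) * (1 / (x0 + 1)))
        = (A * x0 + B) / (x0 ^ 2 - 1) := by
      field_simp
      ring
    rw [hlog]
    norm_num
    ring
  have hfirst : HasDerivAt (fun t => L t xm1 xm2) ((xm1 ^ 2 - 1) * xm2) x0 := by
    simp only [hL]
    refine (((hid.const_mul ((xm1 ^ 2 - 1) * xm2)).add_const _).add_const _).congr_deriv ?_
    ring
  rw [h3.deriv, hmid.deriv, hfirst.deriv]
  have hdiv : (A * x0 + B) / (1 - x0 ^ 2) = -((A * x0 + B) / (x0 ^ 2 - 1)) := by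
    rw [← div_neg, neg_sub]
  rw [hdiv]
  refine ⟨by ring, fun h => ?_, fun h => ?_⟩ <;> linear_combination -h
end

section
/- Let c₀, c₁, c₂, c₃ ∈ ℝ and for n ∈ ℤ define L_n : ℝ³ → ℝ by L_n(z, y, x) = x·y·z + z·y·(c₃ + z + y) + z³/3 + c₃·z²/2 + c₂·z + [n + 2 − c₀·(−1)^n − c₁]·log z (real logarithm). Then for all n ∈ ℤ and all real x_{n+2}, x_{n+1}, x_n, x_{n−1}, x_{n−2} with x_n ≠ 0, the discrete Euler–Lagrange expression satisfies x_n · [ ∂₃L_n(x_{n+2}, x_{n+1}, x_n) + ∂₂L_{n−1}(x_{n+1}, x_n, x_{n−1}) + ∂₁L_{n−2}(x_n, x_{n−1}, x_{n−2}) ] = x_n(x_{n+1}x_{n+2} + x_{n−1}x_{n−2}) + x_n x_{n−1} x_{n+1} + 2x_n²(x_{n+1} + x_{n−1}) + x_n(x_{n+1}² + x_n² + x_{n−1}²) + c₃·x_n·(x_{n−1} + x_n + x_{n+1}) + c₂·x_n − (c₁ + c₀·(−1)^n − n). Consequently, on solutions with x_n ≠ 0, the Euler–Lagrange equation of (L_n)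 is the dP_I^(2) equation x_n(x_{n+1}x_{n+2} + x_{n−1}x_{n−2}) + x_n x_{n−1} x_{n+1} + 2x_n²(x_{n+1} + x_{n−1}) + x_n(x_{n+1}² + x_n² + x_{n−1}²) + c₃ x_n(x_{n−1} + x_n + x_{n+1}) + c₂ x_n = c₁ + c₀(−1)^n − n. -/
/-- The non-autonomous Lagrangian
`L_n(z,y,x) = xyz + zy(c₃+z+y) + z³/3 + c₃z²/2 + c₂z + [n+2-c₀(-1)ⁿ-c₁] log z`
has as discrete Euler--Lagrange equation (on solutions with `x_n ≠ 0`) the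
dP_I^(2) equation. Here `∂ᵢ` is realised as `deriv` of the corresponding
one-variable section, and the three partial derivatives are evaluated with `x_n`
in the differentiated slot. -/
theorem el_equation_of_dPI2_lagrangian (c0 c1 c2 c3 : ℝ) (L : ℤ → ℝ → ℝ → ℝ → ℝ)
    (hL : ∀ (n : ℤ) (z y x : ℝ), L n z y x
      = x * y * z + z * y * (c3 + z + y) + z ^ 3 / 3 + c3 * z ^ 2 / 2 + c2 * z
        + ((n : ℝ) + 2 - c0 * (-1 : ℝ) ^ n - c1) * Real.log z) :
    ∀ (n : ℤ) (x2 x1 x0 xm1 xm2 : ℝ), x0 ≠ 0 →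
      (x0 * (deriv (fun t => L n x2 x1 t) x0 + deriv (fun t => L (n - 1) x1 t xm1) x0
          + deriv (fun t => L (n - 2) t xm1 xm2) x0)
        = x0 * (x1 * x2 + xm1 * xm2) + x0 * xm1 * x1 + 2 * x0 ^ 2 * (x1 + xm1)
          + x0 * (x1 ^ 2 + x0 ^ 2 + xm1 ^ 2) + c3 * x0 * (xm1 + x0 + x1) + c2 * x0
          - (c1 + c0 * (-1 : ℝ) ^ n - (n : ℝ))) ∧
      ((deriv (fun t => L n x2 x1 t) x0 + deriv (fun t => L (n - 1) x1 t xm1) x0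
          + deriv (fun t => L (n - 2) t xm1 xm2) x0 = 0) →
        x0 * (x1 * x2 + xm1 * xm2) + x0 * xm1 * x1 + 2 * x0 ^ 2 * (x1 + xm1)
          + x0 * (x1 ^ 2 + x0 ^ 2 + xm1 ^ 2) + c3 * x0 * (xm1 + x0 + x1) + c2 * x0
          = c1 + c0 * (-1 : ℝ) ^ n - (n : ℝ)) := by
  intro n x2 x1 x0 xm1 xm2 h0
  have h3 : deriv (fun t => L n x2 x1 t) x0 = x1 * x2 := by
    simp only [hL]
    refine HasDerivAt.deriv ?_
    have h := ((((((hasDerivAt_id' x0).mul_const x1).mul_const x2).add_const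
      (x2 * x1 * (c3 + x2 + x1))).add_const (x2 ^ 3 / 3)).add_const
      (c3 * x2 ^ 2 / 2)).add_const (c2 * x2)
    exact (h.add_const (((n : ℝ) + 2 - c0 * (-1 : ℝ) ^ n - c1) * Real.log x2)).congr_deriv
      (by ring)
  have h2 : deriv (fun t => L (n - 1) x1 t xm1) x0
      = xm1 * x1 + x1 * (c3 + x1 + 2 * x0) := by
    simp only [hL]
    refine HasDerivAt.deriv ?_
    have ht := hasDerivAt_id' x0
    have h := ((ht.const_mul xm1).mul_const x1).add
      ((ht.const_mul x1).mul (ht.const_add (c3 + x1)))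
    exact ((((h.add_const (x1 ^ 3 / 3)).add_const (c3 * x1 ^ 2 / 2)).add_const
      (c2 * x1)).add_const _).congr_deriv (by ring)
  have hpow : (-1 : ℝ) ^ (n - 2) = (-1 : ℝ) ^ n := by
    rw [zpow_sub₀ (by norm_num)]
    norm_num
  have h1 : deriv (fun t => L (n - 2) t xm1 xm2) x0
      = xm2 * xm1 + xm1 * (c3 + 2 * x0 + xm1) + x0 ^ 2 + c3 * x0 + c2
        + ((n : ℝ) - c0 * (-1 : ℝ) ^ n - c1) * x0⁻¹ := by
    simp only [hL, hpow]
    refine HasDerivAt.deriv ?_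
    have ht := hasDerivAt_id' x0
    have h := ((((ht.const_mul (xm2 * xm1)).add
      ((ht.mul_const xm1).mul ((ht.const_add c3).add_const xm1))).add
      ((ht.pow 3).div_const 3)).add (((ht.pow 2).const_mul c3).div_const 2)).add
      (ht.const_mul c2)
    refine (h.add ((Real.hasDerivAt_log h0).const_mul _)).congr_deriv ?_
    push_cast
    ring
  have key : x0 * (deriv (fun t => L n x2 x1 t) x0 + deriv (fun t => L (n - 1) x1 t xm1) x0
          + deriv (fun t => L (n - 2) t xm1 xm2) x0)
        = x0 * (x1 * x2 + xm1 * xm2) + x0 * xm1 * x1 + 2 * x0 ^ 2 * (x1 + xm1)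
          + x0 * (x1 ^ 2 + x0 ^ 2 + xm1 ^ 2) + c3 * x0 * (xm1 + x0 + x1) + c2 * x0
          - (c1 + c0 * (-1 : ℝ) ^ n - (n : ℝ)) := by
    rw [h1, h2, h3]
    field_simp
    ring
  refine ⟨key, fun h => ?_⟩
  rw [h, mul_zero] at key
  linarith
end

section
/- Let p, q be integers with 1 ≤ p < q, let F : ℝ → ℝ be defined by F(x) = ∫₀^x log(1 + e^t) dt, and let L be the function of the k+1 = p+q+1 variables (x_{n+p+q}, …, x_n) given by L = x_n·x_{n+p} + x_n·x_{n+q} − F(x_n + x_{n+p+q}), depending only on x_n, x_{n+p}, x_{n+q}, x_{n+p+q}. Then for all real numbers x_{n+p+q}, …, x_{n−p−q}, the discrete Euler–Lagrange expression of L (of order k = p+q) equals x_{n+p} + x_{n−p} + x_{n+q} + x_{n−q} − log[(1 + e^{x_n + x_{n+p+q}})·(1 + e^{x_{n−p−q} + x_n})]; hence the Euler–Lagrange equation of L is x_{n+p} + x_{n−p} + x_{n+q} + x_{n−q} = log[(1 + e^{x_n + x_{n+p+q}})(1 + e^{x_{n−p−q} + x_n})]. -/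
/-- The discrete Euler--Lagrange expression of an autonomous discrete Lagrangian
`L : ℝ^{k+1} → ℝ` of order `k`, written `L(x_{n+k},…,x_n)` (argument slot `j`
corresponding to `x_{n+k-j}`): the `2k+1` variables `(x_{n+k},…,x_{n-k})` are
encoded as `X : Fin (2k+1) → ℝ` with index `m` corresponding to `x_{n+k-m}`, and
`E(L)(X) = ∑_{l=0}^{k} ∂L/∂x_n (x_{n+k-l},…,x_{n-l})`. -/
noncomputable def elSumAut (k : ℕ) (L : (Fin (k + 1) → ℝ) → ℝ)
    (X : Fin (2 * k + 1) → ℝ) : ℝ :=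
  ∑ l : Fin (k + 1),
    fderiv ℝ L
      (fun j : Fin (k + 1) => X ⟨l.val + j.val, by have := l.isLt; have := j.isLt; omega⟩)
      (Pi.single (⟨k - l.val, by omega⟩ : Fin (k + 1)) 1)

theorem continuous_log_one_add_exp : Continuous fun t : ℝ => Real.log (1 + Real.exp t) :=
  (by fun_prop : Continuous fun t : ℝ => 1 + Real.exp t).log fun t => by positivity

theorem hasDerivAt_of_eq_integral_log_one_add_exp {F : ℝ → ℝ}
    (hF : ∀ x : ℝ, F x = ∫ t in (0 : ℝ)..x, Real.log (1 + Real.exp t)) (x : ℝ) :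
    HasDerivAt F (Real.log (1 + Real.exp x)) x := by
  rw [funext hF]
  exact continuous_log_one_add_exp.integral_hasStrictDerivAt 0 x |>.hasDerivAt

theorem fderiv_mul_add_mul_sub_comp_add {ι : Type*} [Fintype ι] {F : ℝ → ℝ} {c : ℝ}
    (a b d e : ι) (y v : ι → ℝ) (hF : HasDerivAt F c (y a + y e)) :
    fderiv ℝ (fun x : ι → ℝ => x a * x b + x a * x d - F (x a + x e)) y v
      = y a * v b + y b * v a + (y a * v d + y d * v a) - c * (v a + v e) := by
  have h (i : ι) : HasFDerivAt (fun x : ι → ℝ => x i)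
      (ContinuousLinearMap.proj (R := ℝ) (φ := fun _ : ι => ℝ) i) y := hasFDerivAt_apply i y
  have hc := hF.comp_hasFDerivAt y ((h a).add (h e))
  have H := (((h a).mul (h b)).add ((h a).mul (h d))).sub hc
  refine (congrArg (fun f => f v) H.fderiv).trans ?_
  simp [mul_add]

/-- Pairing with the antidiagonal unit vectors selects the entry `l = k - i`. -/
theorem Fin.sum_mul_single_sub {k : ℕ} (f : Fin (k + 1) → ℝ) (i : Fin (k + 1)) :
    ∑ l : Fin (k + 1), f l * (Pi.single (⟨k - l.val, by omega⟩ : Fin (k + 1)) 1 :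
      Fin (k + 1) → ℝ) i = f ⟨k - i.val, by omega⟩ := by
  rw [Finset.sum_eq_single ⟨k - i.val, by omega⟩]
  · have : (⟨k - (k - i.val), by omega⟩ : Fin (k + 1)) = i := Fin.ext (by simp; omega)
    simp [this]
  · intro l _ hl
    rw [Pi.single_eq_of_ne, mul_zero]
    rintro rfl
    exact hl (Fin.ext (by simp; omega))
  · simp

/-- The Adler--Startsev discrete Liouville Lagrangian
`L = x_n x_{n+p} + x_n x_{n+q} - F(x_n + x_{n+p+q})`, `F(x) = ∫₀ˣ log(1+eᵗ) dt`,
of order `k = p + q` has the discrete Euler--Lagrange expression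
`x_{n+p} + x_{n-p} + x_{n+q} + x_{n-q}
  - log[(1+e^{x_n+x_{n+p+q}})(1+e^{x_{n-p-q}+x_n})]`.
In a Lagrangian of order `k = p+q`: slot of `x_n` is `p+q`, slot of `x_{n+p}` is
`q`, slot of `x_{n+q}` is `p`, slot of `x_{n+p+q}` is `0`; in the full vector `X`,
index `m` corresponds to `x_{n+p+q-m}`. -/
theorem el_equation_of_liouville_lagrangian (p q : ℕ) (hp : 1 ≤ p) (hpq : p < q)
    (F : ℝ → ℝ)
    (hF : ∀ x : ℝ, F x = ∫ t in (0 : ℝ)..x, Real.log (1 + Real.exp t))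
    (L : (Fin (p + q + 1) → ℝ) → ℝ)
    (hL : ∀ x : Fin (p + q + 1) → ℝ, L x
      = x ⟨p + q, by omega⟩ * x ⟨q, by omega⟩ + x ⟨p + q, by omega⟩ * x ⟨p, by omega⟩
        - F (x ⟨p + q, by omega⟩ + x ⟨0, by omega⟩)) :
    ∀ X : Fin (2 * (p + q) + 1) → ℝ,
      elSumAut (p + q) L X
        = X ⟨q, by omega⟩ + X ⟨p + q + p, by omega⟩
          + X ⟨p, by omega⟩ + X ⟨p + q + q, by omega⟩
          - Real.log ((1 + Real.exp (X ⟨p + q, by omega⟩ + X ⟨0, by omega⟩))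
              * (1 + Real.exp (X ⟨2 * (p + q), by omega⟩ + X ⟨p + q, by omega⟩))) := by
  intro X
  obtain rfl : L = _ := funext hL
  have hFd := hasDerivAt_of_eq_integral_log_one_add_exp hF
  rw [Real.log_mul (by positivity) (by positivity)]
  unfold elSumAut
  simp only [fderiv_mul_add_mul_sub_comp_add _ _ _ _ _ _ (hFd _), @mul_add ℝ,
    Finset.sum_sub_distrib, Finset.sum_add_distrib, Fin.sum_mul_single_sub]
  simp only [Nat.sub_self, Nat.sub_zero, Nat.add_sub_cancel, Nat.add_sub_cancel_left,
    Nat.zero_add, Nat.add_zero, two_mul, Nat.add_comm q (p + q),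
    Nat.add_comm p (p + q)]
  ring
end

section
/- Let α, β, δ ∈ ℝ and define L : ℝ³ → ℝ by L(u, v, w) = (1/2)w² − (1/2)u(u² − α)w + (α + (7/2)u²)v² + (1/2)u(2u⁵ + αu³ + δu + 2β). Let u : ℝ → ℝ be four times continuously differentiable. Then for every t ∈ ℝ the continuous Euler–Lagrange expression of L along u satisfies (d²/dt²)[∂₃L(u(t), u′(t), u″(t))] − (d/dt)[∂₂L(u(t), u′(t), u″(t))] + ∂₁L(u(t), u′(t), u″(t)) = u⁗(t) − α·u″(t) − 10·u(t)²·u″(t) − 10·u(t)·u′(t)² + 6·u(t)⁵ + 2α·u(t)³ + δ·u(t) + β; hence the Euler–Lagrange equation of L is the P_II^(2) equation u⁗ − αu″ − 10u²u″ + (δ − 10(u′)²)u + 6u⁵ + 2αu³ + β = 0. -/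
/-- The continuous Lagrangian
`L(u,v,w) = ½w² - ½u(u²-α)w + (α + 7/2 u²)v² + ½u(2u⁵ + αu³ + δu + 2β)`
has as Euler--Lagrange equation the `P_II^(2)` equation
`u⁗ - αu″ - 10u²u″ + (δ - 10(u′)²)u + 6u⁵ + 2αu³ + β = 0`.
The Euler--Lagrange expression along a `C⁴` curve `u` is
`(d²/dt²)[∂₃L(u,u′,u″)] - (d/dt)[∂₂L(u,u′,u″)] + ∂₁L(u,u′,u″)`, with partial
derivatives realised as `deriv` of one-variable sections. -/
theorem el_equation_of_PII2_lagrangian (α β δ : ℝ) (L : ℝ → ℝ → ℝ → ℝ)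
    (hL : ∀ u v w : ℝ, L u v w
      = (1 / 2) * w ^ 2 - (1 / 2) * u * (u ^ 2 - α) * w + (α + (7 / 2) * u ^ 2) * v ^ 2
        + (1 / 2) * u * (2 * u ^ 5 + α * u ^ 3 + δ * u + 2 * β))
    (u : ℝ → ℝ) (hu : ContDiff ℝ 4 u) :
    ∀ t : ℝ,
      deriv (deriv (fun s => deriv (fun w => L (u s) (deriv u s) w) (deriv (deriv u) s))) t
        - deriv (fun s => deriv (fun v => L (u s) v (deriv (deriv u) s)) (deriv u s)) t
        + deriv (fun a => L a (deriv u t) (deriv (deriv u) t)) (u t)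
      = deriv (deriv (deriv (deriv u))) t - α * deriv (deriv u) t
        - 10 * (u t) ^ 2 * deriv (deriv u) t - 10 * u t * (deriv u t) ^ 2
        + 6 * (u t) ^ 5 + 2 * α * (u t) ^ 3 + δ * u t + β := by
  intro t
  have hu₁ : ContDiff ℝ 3 (deriv u) := ContDiff.deriv' (n := 3) (by norm_num; exact hu)
  have hu₂ : ContDiff ℝ 2 (deriv (deriv u)) := ContDiff.deriv' (n := 2) (by norm_num; exact hu₁)
  have hu₃ : ContDiff ℝ 1 (deriv (deriv (deriv u))) :=
    ContDiff.deriv' (n := 1) (by norm_num; exact hu₂)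
  have d₀ (s : ℝ) : HasDerivAt u (deriv u s) s :=
    (hu.differentiable (by norm_num) s).hasDerivAt
  have d₁ (s : ℝ) : HasDerivAt (deriv u) (deriv (deriv u) s) s :=
    (hu₁.differentiable (by norm_num) s).hasDerivAt
  have d₂ (s : ℝ) : HasDerivAt (deriv (deriv u)) (deriv (deriv (deriv u)) s) s :=
    (hu₂.differentiable (by norm_num) s).hasDerivAt
  have d₃ (s : ℝ) :
      HasDerivAt (deriv (deriv (deriv u))) (deriv (deriv (deriv (deriv u))) s) s :=
    (hu₃.differentiable (by norm_num) s).hasDerivAt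
  have hw (a v w : ℝ) : deriv (fun x => L a v x) w = w - 1 / 2 * (a ^ 3 - α * a) := by
    have h := ((((hasDerivAt_id' w).pow 2).const_mul (1 / 2)).sub
      ((hasDerivAt_id' w).const_mul (1 / 2 * a * (a ^ 2 - α)))).add_const
        ((α + 7 / 2 * a ^ 2) * v ^ 2
          + 1 / 2 * a * (2 * a ^ 5 + α * a ^ 3 + δ * a + 2 * β))
    refine ((h.congr_of_eventuallyEq (.of_forall fun x => ?_)).congr_deriv ?_).deriv
    · simp [hL]; ring
    · norm_num; ring
  have hv (a v w : ℝ) :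
      deriv (fun x => L a x w) v = 2 * α * v + 7 * (a ^ 2 * v) := by
    have h := (((hasDerivAt_id' v).pow 2).const_mul (α + 7 / 2 * a ^ 2)).add_const
      (1 / 2 * w ^ 2 - 1 / 2 * a * (a ^ 2 - α) * w
        + 1 / 2 * a * (2 * a ^ 5 + α * a ^ 3 + δ * a + 2 * β))
    refine ((h.congr_of_eventuallyEq (.of_forall fun x => ?_)).congr_deriv ?_).deriv
    · simp [hL]; ring
    · norm_num; ring
  have ha (a v w : ℝ) :
      deriv (fun x => L x v w) a = -(1 / 2) * (3 * a ^ 2 - α) * w + 7 * a * v ^ 2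
        + 6 * a ^ 5 + 2 * α * a ^ 3 + δ * a + β := by
    have p (n : ℕ) (c : ℝ) := ((hasDerivAt_id' a).pow n).const_mul c
    have h := ((((((p 6 1).add (p 4 (α / 2))).add (p 3 (-(w / 2)))).add
      (p 2 (7 / 2 * v ^ 2 + δ / 2))).add (p 1 (α * w / 2 + β))).add_const
        (1 / 2 * w ^ 2 + α * v ^ 2))
    refine ((h.congr_of_eventuallyEq (.of_forall fun x => ?_)).congr_deriv ?_).deriv
    · simp [hL]; ring
    · norm_num; ring
  have hdw : deriv (fun s => deriv (deriv u) s - 1 / 2 * (u s ^ 3 - α * u s)) =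
      fun s => deriv (deriv (deriv u)) s
        - 1 / 2 * (3 * (u s ^ 2 * deriv u s) - α * deriv u s) := by
    funext s
    have h := (d₂ s).sub ((((d₀ s).pow 3).sub ((d₀ s).const_mul α)).const_mul (1 / 2))
    refine HasDerivAt.deriv (h.congr_deriv ?_)
    norm_num; ring
  have hddw : deriv (fun s => deriv (deriv (deriv u)) s
      - 1 / 2 * (3 * (u s ^ 2 * deriv u s) - α * deriv u s)) t = _ :=
    ((d₃ t).sub ((((((d₀ t).pow 2).mul (d₁ t)).const_mul 3).sub
      ((d₁ t).const_mul α)).const_mul (1 / 2))).deriv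
  have hdv : deriv (fun s => 2 * α * deriv u s + 7 * (u s ^ 2 * deriv u s)) t = _ :=
    (((d₁ t).const_mul (2 * α)).add
      ((((d₀ t).pow 2).mul (d₁ t)).const_mul 7)).deriv
  simp only [hw, hv, ha]
  rw [hdw, hddw, hdv]
  norm_num
  ring
end
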